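/- arXiv:2404.16328 — 3 statements merged into one kernel-verified Lean document; each statement's English description precedes it below -/
import Mathlib

section
/- Gap safe sample screening rule for the weighted L1-loss L2-regularized SVM: let X̌ ∈ ℝ^{n×d}, w ∈ ℝ^n with wᵢ ≥ 0, λ > 0, and let β*(w) be the minimizer of P_w(β) = Σᵢ wᵢ max(0, 1 − X̌_{i:}β) + (λ/2)‖β‖₂². Fix i ∈ [n], β̂ ∈ ℝ^d and α̂ ∈ [0,1]^n, and set r = √((2/λ)(P_w(β̂) − D_w(α̂))). If X̌_{i:}β̂ − ‖X̌_{i:}‖₂ · r > 1, then X̌_{i:}β*(w) > 1. -/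
/-- Primal objective of the weighted L1-loss L2-regularized SVM. -/
noncomputable def svmPrimal {n d : ℕ} (X : Matrix (Fin n) (Fin d) ℝ) (w : Fin n → ℝ)
    (lam : ℝ) (β : Fin d → ℝ) : ℝ :=
  ∑ i, w i * max 0 (1 - ∑ j, X i j * β j) + (lam / 2) * ∑ j, (β j) ^ 2

/-- Dual objective of the weighted L1-loss L2-regularized SVM on the box `[0,1]^n`. -/
noncomputable def svmDual {n d : ℕ} (X : Matrix (Fin n) (Fin d) ℝ) (w : Fin n → ℝ)
    (lam : ℝ) (α : Fin n → ℝ) : ℝ :=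
  ∑ i, w i * α i - (1 / (2 * lam)) * ∑ j, (∑ i, w i * α i * X i j) ^ 2

theorem svmDual_le_svmPrimal {n d : ℕ} (X : Matrix (Fin n) (Fin d) ℝ) (w : Fin n → ℝ)
    (hw : ∀ i, 0 ≤ w i) {lam : ℝ} (hlam : 0 < lam) (α : Fin n → ℝ)
    (hα : ∀ k, 0 ≤ α k ∧ α k ≤ 1) (β : Fin d → ℝ) :
    svmDual X w lam α ≤ svmPrimal X w lam β := by
  unfold svmDual svmPrimal
  have hinge : ∑ i, w i * α i - ∑ i, w i * α i * ∑ j, X i j * β j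
      ≤ ∑ i, w i * max 0 (1 - ∑ j, X i j * β j) := by
    rw [← Finset.sum_sub_distrib]
    refine Finset.sum_le_sum fun i _ => ?_
    have h : α i * (1 - ∑ j, X i j * β j) ≤ max 0 (1 - ∑ j, X i j * β j) :=
      (mul_le_mul_of_nonneg_left (le_max_right _ _) (hα i).1).trans
        (mul_le_of_le_one_left (le_max_left _ _) (hα i).2)
    linarith [mul_le_mul_of_nonneg_left h (hw i)]
  have swap : ∑ i, w i * α i * ∑ j, X i j * β j = ∑ j, (∑ i, w i * α i * X i j) * β j := by
    simp only [Finset.mul_sum, Finset.sum_mul]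
    rw [Finset.sum_comm]
    simp only [mul_assoc]
  have young : ∑ j, (∑ i, w i * α i * X i j) * β j
      ≤ (lam / 2) * ∑ j, (β j) ^ 2 + (1 / (2 * lam)) * ∑ j, (∑ i, w i * α i * X i j) ^ 2 := by
    rw [Finset.mul_sum, Finset.mul_sum, ← Finset.sum_add_distrib]
    refine Finset.sum_le_sum fun j _ => ?_
    generalize ∑ i, w i * α i * X i j = v
    have h : (lam / 2) * (β j) ^ 2 + (1 / (2 * lam)) * v ^ 2 - v * β j
        = (lam * β j - v) ^ 2 / (2 * lam) := by
      field_simp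
      ring
    have : 0 ≤ (lam * β j - v) ^ 2 / (2 * lam) := by positivity
    linarith
  linarith

theorem svmPrimal_combination_le {n d : ℕ} (X : Matrix (Fin n) (Fin d) ℝ) (w : Fin n → ℝ)
    (hw : ∀ i, 0 ≤ w i) (lam : ℝ) (β γ : Fin d → ℝ) {t : ℝ} (ht0 : 0 ≤ t) (ht1 : t ≤ 1) :
    svmPrimal X w lam (fun j => (1 - t) * β j + t * γ j)
      ≤ (1 - t) * svmPrimal X w lam β + t * svmPrimal X w lam γ
        - lam / 2 * (t * (1 - t)) * ∑ j, (γ j - β j) ^ 2 := by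
  unfold svmPrimal
  have hinge : ∑ i, w i * max 0 (1 - ∑ j, X i j * ((1 - t) * β j + t * γ j))
      ≤ (1 - t) * ∑ i, w i * max 0 (1 - ∑ j, X i j * β j)
        + t * ∑ i, w i * max 0 (1 - ∑ j, X i j * γ j) := by
    rw [Finset.mul_sum, Finset.mul_sum, ← Finset.sum_add_distrib]
    refine Finset.sum_le_sum fun i _ => ?_
    have lin : ∑ j, X i j * ((1 - t) * β j + t * γ j)
        = (1 - t) * ∑ j, X i j * β j + t * ∑ j, X i j * γ j := by
      rw [Finset.mul_sum, Finset.mul_sum, ← Finset.sum_add_distrib]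
      exact Finset.sum_congr rfl fun j _ => by ring
    rw [lin]
    generalize ∑ j, X i j * β j = a
    generalize ∑ j, X i j * γ j = b
    have h : max 0 (1 - ((1 - t) * a + t * b))
        ≤ (1 - t) * max 0 (1 - a) + t * max 0 (1 - b) := by
      have s0 : 0 ≤ 1 - t := sub_nonneg.2 ht1
      refine max_le (by positivity) ?_
      linarith [mul_le_mul_of_nonneg_left (le_max_right 0 (1 - a)) s0,
        mul_le_mul_of_nonneg_left (le_max_right 0 (1 - b)) ht0]
    linarith [mul_le_mul_of_nonneg_left h (hw i)]
  have quad : ∑ j, ((1 - t) * β j + t * γ j) ^ 2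
      = (1 - t) * ∑ j, (β j) ^ 2 + t * ∑ j, (γ j) ^ 2
        - t * (1 - t) * ∑ j, (γ j - β j) ^ 2 := by
    rw [Finset.mul_sum, Finset.mul_sum, Finset.mul_sum, ← Finset.sum_add_distrib,
      ← Finset.sum_sub_distrib]
    exact Finset.sum_congr rfl fun j _ => by ring
  rw [quad]
  linarith

theorem svmPrimal_quadratic_growth {n d : ℕ} (X : Matrix (Fin n) (Fin d) ℝ) (w : Fin n → ℝ)
    (hw : ∀ i, 0 ≤ w i) (lam : ℝ) (β : Fin d → ℝ)
    (hmin : ∀ γ, svmPrimal X w lam β ≤ svmPrimal X w lam γ) (γ : Fin d → ℝ) :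
    lam / 2 * ∑ j, (γ j - β j) ^ 2 ≤ svmPrimal X w lam γ - svmPrimal X w lam β := by
  by_contra! hlt
  have gap : 0 ≤ svmPrimal X w lam γ - svmPrimal X w lam β := sub_nonneg.2 (hmin γ)
  have comb := fun (t : ℝ) (h0 : 0 ≤ t) (h1 : t ≤ 1) =>
    (hmin _).trans (svmPrimal_combination_le X w hw lam β γ h0 h1)
  generalize ∑ j, (γ j - β j) ^ 2 = S at *
  generalize svmPrimal X w lam γ = Q at *
  generalize svmPrimal X w lam β = P at *
  have hA : 0 < lam / 2 * S := gap.trans_lt hlt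
  obtain ⟨t, ht⟩ : ∃ t, t = (lam / 2 * S - (Q - P)) / (2 * (lam / 2 * S)) := ⟨_, rfl⟩
  have htA : t * (lam / 2 * S) = (lam / 2 * S - (Q - P)) / 2 := by
    rw [ht, div_mul_eq_mul_div, mul_comm (2 : ℝ), ← div_div, mul_div_cancel_right₀ _ hA.ne']
  have ht0 : 0 < t := ht ▸ div_pos (by linarith) (by linarith)
  have ht1 : t ≤ 1 := ht ▸ (div_le_one (by linarith)).2 (by linarith)
  have key : 0 ≤ t * ((Q - P) - (1 - t) * (lam / 2 * S)) := by
    linarith [comb t ht0.le ht1]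
  have := nonneg_of_mul_nonneg_right key ht0
  linarith

/-- Gap safe sample screening rule for the weighted L1-loss
L2-regularized SVM: with `r = √((2/λ)(P_w(βhat) − D_w(αhat)))`, if
`X̌_{i:}βhat − ‖X̌_{i:}‖₂ · r > 1` then `X̌_{i:}βstar > 1`. -/
theorem stmt5 {n d : ℕ} (X : Matrix (Fin n) (Fin d) ℝ) (w : Fin n → ℝ)
    (hw : ∀ i, 0 ≤ w i) (lam : ℝ) (hlam : 0 < lam)
    (βstar : Fin d → ℝ)
    (hmin : ∀ β : Fin d → ℝ, svmPrimal X w lam βstar ≤ svmPrimal X w lam β)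
    (i : Fin n) (βhat : Fin d → ℝ) (αhat : Fin n → ℝ)
    (hαhat : ∀ k, 0 ≤ αhat k ∧ αhat k ≤ 1)
    (r : ℝ) (hr : r = Real.sqrt ((2 / lam) * (svmPrimal X w lam βhat - svmDual X w lam αhat)))
    (hrule : 1 < (∑ j, X i j * βhat j) - Real.sqrt (∑ j, (X i j) ^ 2) * r) :
    1 < ∑ j, X i j * βstar j := by
  have growth := svmPrimal_quadratic_growth X w hw lam βstar hmin βhat
  have weak := svmDual_le_svmPrimal X w hw hlam αhat hαhat βstar
  have dist : Real.sqrt (∑ j, (βhat j - βstar j) ^ 2) ≤ r := by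
    rw [hr]
    refine Real.sqrt_le_sqrt ?_
    rw [div_mul_eq_mul_div, le_div_iff₀ hlam]
    linarith
  have cauchy := Real.sum_mul_le_sqrt_mul_sqrt Finset.univ (X i) (fun j => βhat j - βstar j)
  have split : ∑ j, X i j * (βhat j - βstar j)
      = ∑ j, X i j * βhat j - ∑ j, X i j * βstar j := by
    rw [← Finset.sum_sub_distrib]
    exact Finset.sum_congr rfl fun j _ => by ring
  have := mul_le_mul_of_nonneg_left dist (Real.sqrt_nonneg (∑ j, (X i j) ^ 2))
  linarith
end

section
/- Screened samples do not affect the trained model: let X̌ ∈ ℝ^{n×d}, w ∈ ℝ^n with wᵢ ≥ 0, λ > 0, and let β* be the minimizer of P_w(β) = Σᵢ wᵢ max(0, 1 − X̌_{i:}β) + (λ/2)‖β‖₂². Fix i ∈ [n] and suppose X̌_{i:}β* > 1. Let w' be the weight vector obtained from w by setting w'ᵢ = 0 and w'ₖ = wₖ for k ≠ i. Then β* is also the (unique) minimizer of P_{w'}. -/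
/-- A linear form evaluated at a point of a segment. -/
lemma sum_mul_segment {d : ℕ} (x a b : Fin d → ℝ) (t : ℝ) :
    ∑ j, x j * ((1 - t) * a j + t * b j) =
      (1 - t) * ∑ j, x j * a j + t * ∑ j, x j * b j := by
  simp only [Finset.mul_sum, ← Finset.sum_add_distrib]
  exact Finset.sum_congr rfl fun j _ => by ring

/-- The hinge objective is strongly convex with modulus `lam` along segments. -/
lemma svmPrimal_segment_le {n d : ℕ} (X : Matrix (Fin n) (Fin d) ℝ) {w : Fin n → ℝ}
    (hw : ∀ i, 0 ≤ w i) (lam : ℝ) (a b : Fin d → ℝ) {t : ℝ} (ht0 : 0 ≤ t) (ht1 : t ≤ 1) :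
    svmPrimal X w lam (fun j => (1 - t) * a j + t * b j) ≤
      (1 - t) * svmPrimal X w lam a + t * svmPrimal X w lam b
        - lam / 2 * (t * (1 - t)) * ∑ j, (a j - b j) ^ 2 := by
  have hsq : ∑ j, ((1 - t) * a j + t * b j) ^ 2 = (1 - t) * ∑ j, a j ^ 2 + t * ∑ j, b j ^ 2
      - (t * (1 - t)) * ∑ j, (a j - b j) ^ 2 := by
    simp only [Finset.mul_sum, ← Finset.sum_add_distrib, ← Finset.sum_sub_distrib]
    exact Finset.sum_congr rfl fun j _ => by ring
  have hhinge : ∑ i, w i * max 0 (1 - ∑ j, X i j * ((1 - t) * a j + t * b j)) ≤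
      (1 - t) * ∑ i, w i * max 0 (1 - ∑ j, X i j * a j)
        + t * ∑ i, w i * max 0 (1 - ∑ j, X i j * b j) := by
    simp only [Finset.mul_sum, ← Finset.sum_add_distrib]
    refine Finset.sum_le_sum fun i _ => ?_
    rw [sum_mul_segment]
    have key : max 0 (1 - ((1 - t) * ∑ j, X i j * a j + t * ∑ j, X i j * b j)) ≤
        (1 - t) * max 0 (1 - ∑ j, X i j * a j) + t * max 0 (1 - ∑ j, X i j * b j) := by
      have ht' : 0 ≤ 1 - t := sub_nonneg.2 ht1
      refine max_le (by positivity) ?_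
      have h₁ := mul_le_mul_of_nonneg_left (le_max_right 0 (1 - ∑ j, X i j * a j)) ht'
      have h₂ := mul_le_mul_of_nonneg_left (le_max_right 0 (1 - ∑ j, X i j * b j)) ht0
      linarith
    linarith [mul_le_mul_of_nonneg_left key (hw i)]
  unfold svmPrimal
  rw [hsq]
  linarith

/-- Dropping a sample whose margin is at least one leaves the objective value unchanged. -/
lemma svmPrimal_update_zero {n d : ℕ} (X : Matrix (Fin n) (Fin d) ℝ) (w : Fin n → ℝ)
    (lam : ℝ) (β : Fin d → ℝ) (i : Fin n) (h : 1 ≤ ∑ j, X i j * β j) :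
    svmPrimal X (Function.update w i 0) lam β = svmPrimal X w lam β := by
  unfold svmPrimal
  congr 1
  refine Finset.sum_congr rfl fun k _ => ?_
  by_cases hk : k = i
  · subst hk
    rw [max_eq_left (sub_nonpos.2 h), mul_zero, mul_zero]
  · rw [Function.update_of_ne hk]

/-- Screened samples do not affect the trained model: if `βstar`
minimizes `P_w` and `X̌_{i:}βstar > 1`, then `βstar` is also the unique minimizer of
`P_{w'}`, where `w'` is obtained from `w` by setting `w'ᵢ = 0` and `w'ₖ = wₖ` for `k ≠ i`. -/
theorem stmt6 {n d : ℕ} (X : Matrix (Fin n) (Fin d) ℝ) (w : Fin n → ℝ)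
    (hw : ∀ i, 0 ≤ w i) (lam : ℝ) (hlam : 0 < lam)
    (βstar : Fin d → ℝ)
    (hmin : ∀ β : Fin d → ℝ, svmPrimal X w lam βstar ≤ svmPrimal X w lam β)
    (i : Fin n) (hscr : 1 < ∑ j, X i j * βstar j)
    (w' : Fin n → ℝ) (hw' : w' = Function.update w i 0) :
    (∀ β : Fin d → ℝ, svmPrimal X w' lam βstar ≤ svmPrimal X w' lam β) ∧
    (∀ β : Fin d → ℝ,
      (∀ β' : Fin d → ℝ, svmPrimal X w' lam β ≤ svmPrimal X w' lam β') → β = βstar) := by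
  subst hw'
  have hw₀ : ∀ k, 0 ≤ Function.update w i 0 k := fun k => by
    by_cases hk : k = i
    · simp [hk]
    · simpa [hk] using hw k
  have growth : ∀ β : Fin d → ℝ, svmPrimal X (Function.update w i 0) lam βstar
      + lam / 4 * ∑ j, (βstar j - β j) ^ 2 ≤ svmPrimal X (Function.update w i 0) lam β := by
    intro β
    obtain ⟨t, ht0, ht2, htm⟩ : ∃ t : ℝ, 0 < t ∧ t ≤ 1 / 2 ∧
        1 ≤ (1 - t) * ∑ j, X i j * βstar j + t * ∑ j, X i j * β j := by
      generalize ∑ j, X i j * βstar j = m at hscr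
      generalize ∑ j, X i j * β j = m'
      have habs := abs_nonneg (m' - m)
      have hD : 0 < 2 * (m - 1) + |m' - m| := by linarith
      refine ⟨(m - 1) / (2 * (m - 1) + |m' - m|), div_pos (by linarith) hD, ?_, ?_⟩
      · rw [div_le_iff₀ hD]
        linarith
      · have ht : 0 < (m - 1) / (2 * (m - 1) + |m' - m|) := div_pos (by linarith) hD
        have heq := div_mul_cancel₀ (m - 1) hD.ne'
        generalize (m - 1) / (2 * (m - 1) + |m' - m|) = t at ht heq
        have h₁ := mul_le_mul_of_nonneg_left (neg_abs_le (m' - m)) ht.le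
        have h₂ := mul_pos ht (sub_pos.2 hscr)
        linarith
    have hconv := svmPrimal_segment_le X hw₀ lam βstar β ht0.le (by linarith : t ≤ 1)
    have hloc := hmin fun j => (1 - t) * βstar j + t * β j
    rw [← svmPrimal_update_zero X w lam βstar i hscr.le,
      ← svmPrimal_update_zero X w lam _ i ((sum_mul_segment (X i) βstar β t).symm ▸ htm)] at hloc
    have hS : 0 ≤ ∑ j, (βstar j - β j) ^ 2 := Finset.sum_nonneg fun j _ => sq_nonneg _
    generalize ∑ j, (βstar j - β j) ^ 2 = S at hconv hS ⊢
    have hslope : svmPrimal X (Function.update w i 0) lam βstar + lam / 2 * (1 - t) * S ≤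
        svmPrimal X (Function.update w i 0) lam β := by
      refine le_of_mul_le_mul_left ?_ ht0
      linarith
    have hhalf := mul_le_mul_of_nonneg_left (by linarith : 1 / 2 ≤ 1 - t)
      (by positivity : 0 ≤ lam / 2 * S)
    linarith
  refine ⟨fun β => ?_, fun β hβ => ?_⟩
  · have hS : 0 ≤ lam / 4 * ∑ j, (βstar j - β j) ^ 2 := by positivity
    linarith [growth β]
  · have hS : ∑ j, (βstar j - β j) ^ 2 ≤ 0 := by
      refine nonpos_of_mul_nonpos_right (a := lam / 4) ?_ (by positivity)
      linarith [growth β, hβ βstar]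
    have hzero := (Finset.sum_eq_zero_iff_of_nonneg fun j _ => sq_nonneg (βstar j - β j)).1
      (hS.antisymm (Finset.sum_nonneg fun j _ => sq_nonneg _))
    funext j
    exact (sub_eq_zero.1 (pow_eq_zero_iff two_ne_zero |>.1 (hzero j (Finset.mem_univ j)))).symm
end

section
/- Safe feature screening condition for the weighted L2-loss L1-regularized SVM: let X̌ ∈ ℝ^{n×d}, w ∈ ℝ^n with wᵢ ≥ 0, λ > 0, and let β* be a minimizer of P_w(β) = Σᵢ wᵢ (max(0, 1 − X̌_{i:}β))² + λ Σ_{j=1}^{d−1} |β_j|. Define α*ᵢ = (2/λ) max(0, 1 − X̌_{i:}β*) for i ∈ [n]. Then for every j ∈ [d−1], if |Σᵢ wᵢ X̌_{ij} α*ᵢ| < 1, then β*_j = 0. -/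
/-- Primal objective of the weighted L2-loss L1-regularized SVM on `ℝ^{d+1}`,
where the last coordinate (the intercept) is unpenalized:
`P_w(β) = Σᵢ wᵢ (max(0, 1 − X̌_{i:}β))² + λ Σ_{j=1}^{d} |βⱼ|`. -/
noncomputable def svmL2L1Primal {n d : ℕ} (X : Matrix (Fin n) (Fin (d + 1)) ℝ)
    (w : Fin n → ℝ) (lam : ℝ) (β : Fin (d + 1) → ℝ) : ℝ :=
  ∑ i, w i * (max 0 (1 - ∑ j, X i j * β j)) ^ 2 + lam * ∑ j : Fin d, |β j.castSucc|

/-- The squared positive part is bounded above by its quadratic model with unit curvature. -/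
theorem sq_max_zero_add_le (u v : ℝ) :
    (max 0 (u + v)) ^ 2 ≤ (max 0 u) ^ 2 + 2 * v * max 0 u + v ^ 2 := by
  rcases max_cases 0 (u + v) with ⟨h, _⟩ | ⟨h, _⟩ <;>
    rcases max_cases 0 u with ⟨h', _⟩ | ⟨h', _⟩ <;> rw [h, h'] <;>
    nlinarith [sq_nonneg (u + v), sq_nonneg v]

/-- Shrinking one penalized coordinate `βₖ` to `(1 - t) βₖ` changes the primal objective by at most
a first-order term plus a quadratic term in `t`. -/
theorem svmL2L1Primal_shrink_le {n d : ℕ} (X : Matrix (Fin n) (Fin (d + 1)) ℝ) (w : Fin n → ℝ)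
    (hw : ∀ i, 0 ≤ w i) (lam : ℝ) (β : Fin (d + 1) → ℝ) (k : Fin d) {t : ℝ} (ht : t ≤ 1) :
    svmL2L1Primal X w lam (Function.update β k.castSucc ((1 - t) * β k.castSucc)) ≤
      svmL2L1Primal X w lam β
        + t * (2 * β k.castSucc * ∑ i, w i * X i k.castSucc * max 0 (1 - ∑ j, X i j * β j)
          - lam * |β k.castSucc|)
        + t ^ 2 * (β k.castSucc ^ 2 * ∑ i, w i * X i k.castSucc ^ 2) := by
  set b := β k.castSucc with hb
  set β' := Function.update β k.castSucc ((1 - t) * b) with hβ'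
  have hmargin (i : Fin n) :
      1 - ∑ j, X i j * β' j = (1 - ∑ j, X i j * β j) + t * b * X i k.castSucc := by
    have h : ∀ j, X i j * β' j =
        X i j * β j - if j = k.castSucc then t * b * X i k.castSucc else 0 := by
      intro j
      by_cases hj : j = k.castSucc
      · subst hj
        simp only [hβ', Function.update_self, if_true, ← hb]
        ring
      · simp [hβ', hj]
    simp only [h, Finset.sum_sub_distrib, Finset.sum_ite_eq', Finset.mem_univ, if_true]
    ring
  have hpen : ∑ j : Fin d, |β' j.castSucc| = ∑ j : Fin d, |β j.castSucc| - t * |b| := by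
    have h : ∀ j : Fin d, |β' j.castSucc| =
        |β j.castSucc| - if j = k then t * |b| else 0 := by
      intro j
      by_cases hj : j = k
      · subst hj
        simp only [hβ', Function.update_self, if_true, ← hb, abs_mul,
          abs_of_nonneg (sub_nonneg.2 ht)]
        ring
      · simp [hβ', hj]
    simp only [h, Finset.sum_sub_distrib, Finset.sum_ite_eq', Finset.mem_univ, if_true]
  have hloss : ∑ i, w i * (max 0 (1 - ∑ j, X i j * β' j)) ^ 2 ≤
      ∑ i, w i * (max 0 (1 - ∑ j, X i j * β j)) ^ 2
        + t * (2 * b * ∑ i, w i * X i k.castSucc * max 0 (1 - ∑ j, X i j * β j))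
        + t ^ 2 * (b ^ 2 * ∑ i, w i * X i k.castSucc ^ 2) := by
    simp only [Finset.mul_sum (s := (Finset.univ : Finset (Fin n))), ← Finset.sum_add_distrib]
    refine Finset.sum_le_sum fun i _ => ?_
    rw [hmargin i]
    refine (mul_le_mul_of_nonneg_left (sq_max_zero_add_le _ _) (hw i)).trans_eq ?_
    ring
  unfold svmL2L1Primal
  rw [hpen]
  linarith

/-- Safe feature screening condition for the weighted L2-loss
L1-regularized SVM: let `βstar` minimize `P_w` and define
`αstarᵢ = (2/λ) max(0, 1 − X̌_{i:}βstar)`. Then for every penalized feature `j`,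
if `|Σᵢ wᵢ X̌ᵢⱼ αstarᵢ| < 1` then `βstarⱼ = 0`. -/
theorem stmt9 {n d : ℕ} (X : Matrix (Fin n) (Fin (d + 1)) ℝ) (w : Fin n → ℝ)
    (hw : ∀ i, 0 ≤ w i) (lam : ℝ) (hlam : 0 < lam)
    (βstar : Fin (d + 1) → ℝ)
    (hmin : ∀ β : Fin (d + 1) → ℝ, svmL2L1Primal X w lam βstar ≤ svmL2L1Primal X w lam β)
    (αstar : Fin n → ℝ)
    (hαstar : ∀ i, αstar i = (2 / lam) * max 0 (1 - ∑ j, X i j * βstar j))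
    (j : Fin d)
    (hcond : |∑ i, w i * X i j.castSucc * αstar i| < 1) :
    βstar j.castSucc = 0 := by
  by_contra hb
  set b := βstar j.castSucc with hbdef
  set S := ∑ i, w i * X i j.castSucc * αstar i with hS
  have hgrad : 2 * ∑ i, w i * X i j.castSucc * max 0 (1 - ∑ k, X i k * βstar k) = lam * S := by
    simp only [hS, hαstar, Finset.mul_sum (s := (Finset.univ : Finset (Fin n)))]
    refine Finset.sum_congr rfl fun i _ => ?_
    field_simp
  have hC : 0 ≤ ∑ i, w i * X i j.castSucc ^ 2 :=
    Finset.sum_nonneg fun i _ => mul_nonneg (hw i) (sq_nonneg _)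
  set D := b ^ 2 * ∑ i, w i * X i j.castSucc ^ 2 with hD
  have hD0 : 0 ≤ D := mul_nonneg (sq_nonneg _) hC
  have hbS : b * S < |b| :=
    calc b * S ≤ |b| * |S| := (le_abs_self _).trans_eq (abs_mul b S)
      _ < |b| := mul_lt_of_lt_one_right (abs_pos.2 hb) hcond
  obtain ⟨e, he⟩ : ∃ e, e = lam * (|b| - b * S) := ⟨_, rfl⟩
  have he0 : 0 < e := he ▸ mul_pos hlam (sub_pos.2 hbS)
  have hDe : 0 < D + e := by linarith
  have ht0 : 0 < e / (D + e) := div_pos he0 hDe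
  have ht1 : e / (D + e) ≤ 1 := (div_le_one hDe).2 (by linarith)
  have htD : e / (D + e) * (D + e) = e := div_mul_cancel₀ _ hDe.ne'
  have hle := (hmin _).trans (svmL2L1Primal_shrink_le X w hw lam βstar j ht1)
  rw [← hbdef, ← hD, mul_right_comm, hgrad] at hle
  have hdecr : 0 ≤ e / (D + e) * (e / (D + e) * D - e) := by
    rw [he] at hle ⊢
    linarith
  have : 0 ≤ e / (D + e) * D - e := nonneg_of_mul_nonneg_right hdecr ht0
  nlinarith [mul_pos ht0 he0]
end
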